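/- arXiv:2407.07348 — 3 statements merged into one kernel-verified Lean document; each statement's English description precedes it below -/
import Mathlib

section
/- Let X be a real random variable, σ₁ > 0 and ρ₁ ≥ 1 constants such that P[|X| ≥ λσ₁] ≤ ρ₁·exp(−λ²/2) for all λ ≥ 0. Then for every positive integer k, E[X^{2k}] ≤ (Σ_{i=0}^{k} (ln ρ₁)^i / i!) · 2^k σ₁^{2k} · k!. -/
open MeasureTheory Real

/-- The antiderivative of `s ^ n * exp (-s)` coming from repeated integration by parts. -/
lemma hasDerivAt_neg_exp_neg_mul_sum (n : ℕ) (s : ℝ) :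
    HasDerivAt (fun s : ℝ ↦ -(exp (-s) * ∑ i ∈ Finset.range (n + 1), s ^ i / (i.factorial : ℝ)))
      (s ^ n / (n.factorial : ℝ) * exp (-s)) s := by
  have hexp : HasDerivAt (fun s : ℝ ↦ exp (-s)) (-exp (-s)) s := by
    simpa using (hasDerivAt_neg s).exp
  induction n with
  | zero => simpa using hexp.fun_neg
  | succ n ih =>
    have hterm : HasDerivAt (fun s : ℝ ↦ s ^ (n + 1) / ((n + 1).factorial : ℝ))
        (s ^ n / (n.factorial : ℝ)) s := by
      refine ((hasDerivAt_pow (n + 1) s).div_const _).congr_deriv ?_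
      rw [Nat.factorial_succ]
      push_cast
      field_simp
    refine ((ih.sub (hexp.mul hterm)).congr_deriv ?_).congr_of_eventuallyEq ?_
    · ring
    · refine Filter.Eventually.of_forall fun t ↦ ?_
      simp only [Finset.sum_range_succ _ (n + 1), Pi.sub_apply, Pi.mul_apply]
      ring

lemma tendsto_neg_exp_neg_mul_sum (n : ℕ) :
    Filter.Tendsto
      (fun s : ℝ ↦ -(exp (-s) * ∑ i ∈ Finset.range (n + 1), s ^ i / (i.factorial : ℝ)))
      Filter.atTop (nhds 0) := by
  have hsum : Filter.Tendsto
      (fun s : ℝ ↦ ∑ i ∈ Finset.range (n + 1), s ^ i * exp (-s) / (i.factorial : ℝ))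
      Filter.atTop (nhds (∑ i ∈ Finset.range (n + 1), 0 / (i.factorial : ℝ))) :=
    tendsto_finsetSum _ fun i _ ↦ (tendsto_pow_mul_exp_neg_atTop_nhds_zero i).div_const _
  have hneg := hsum.neg
  simp only [zero_div, Finset.sum_const_zero, neg_zero] at hneg
  refine hneg.congr fun s ↦ ?_
  rw [Finset.mul_sum]
  congr 1
  exact Finset.sum_congr rfl fun i _ ↦ by ring

/-- The incomplete Gamma integral at a positive integer, as a Lebesgue integral. -/
lemma lintegral_Ioi_pow_div_factorial_mul_exp_neg (n : ℕ) {L : ℝ} (hL : 0 ≤ L) :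
    ∫⁻ s in Set.Ioi L, ENNReal.ofReal (s ^ n / (n.factorial : ℝ) * exp (-s)) =
      ENNReal.ofReal (exp (-L) * ∑ i ∈ Finset.range (n + 1), L ^ i / (i.factorial : ℝ)) := by
  have hnonneg : ∀ s ∈ Set.Ioi L, 0 ≤ s ^ n / (n.factorial : ℝ) * exp (-s) := fun s hs ↦ by
    have : 0 ≤ s := hL.trans (le_of_lt hs)
    positivity
  have hint := integrableOn_Ioi_deriv_of_nonneg' (a := L)
    (fun s _ ↦ hasDerivAt_neg_exp_neg_mul_sum n s) hnonneg (tendsto_neg_exp_neg_mul_sum n)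
  have heq := integral_Ioi_of_hasDerivAt_of_nonneg' (a := L)
    (fun s _ ↦ hasDerivAt_neg_exp_neg_mul_sum n s) hnonneg (tendsto_neg_exp_neg_mul_sum n)
  rw [← ofReal_integral_eq_lintegral_ofReal hint
    ((ae_restrict_iff' measurableSet_Ioi).2 (Filter.Eventually.of_forall hnonneg)), heq]
  simp

lemma integral_pow_div_factorial (n : ℕ) (y : ℝ) :
    ∫ s in (0 : ℝ)..y, s ^ n / (n.factorial : ℝ) = y ^ (n + 1) / ((n + 1).factorial : ℝ) := by
  rw [intervalIntegral.integral_div, integral_pow, Nat.factorial_succ]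
  push_cast
  field_simp
  simp

lemma lintegral_Ioc_pow_div_factorial (n : ℕ) {L : ℝ} (hL : 0 ≤ L) :
    ∫⁻ s in Set.Ioc 0 L, ENNReal.ofReal (s ^ n / (n.factorial : ℝ)) =
      ENNReal.ofReal (L ^ (n + 1) / ((n + 1).factorial : ℝ)) := by
  have hint : IntegrableOn (fun s : ℝ ↦ s ^ n / (n.factorial : ℝ)) (Set.Ioc 0 L) :=
    (by fun_prop : Continuous fun s : ℝ ↦ s ^ n / (n.factorial : ℝ)).integrableOn_Ioc
  rw [← ofReal_integral_eq_lintegral_ofReal hint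
    ((ae_restrict_iff' measurableSet_Ioc).2 (Filter.Eventually.of_forall fun s hs ↦ by
      have : 0 ≤ s := hs.1.le
      positivity)), ← intervalIntegral.integral_of_le hL,
    integral_pow_div_factorial]

/-- Moment bound for a nonnegative random variable with subexponential tails. -/
lemma lintegral_pow_div_factorial_le_of_tail {Ω : Type*} [MeasurableSpace Ω] (μ : Measure Ω)
    [IsProbabilityMeasure μ] {Y : Ω → ℝ} (hY : AEMeasurable Y μ) (hY0 : 0 ≤ Y) {ρ : ℝ}
    (hρ : 1 ≤ ρ) (htail : ∀ s : ℝ, 0 ≤ s → μ.real {ω | s ≤ Y ω} ≤ ρ * exp (-s)) (n : ℕ) :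
    ∫⁻ ω, ENNReal.ofReal (Y ω ^ (n + 1) / ((n + 1).factorial : ℝ)) ∂μ ≤
      ENNReal.ofReal (∑ i ∈ Finset.range (n + 2), log ρ ^ i / (i.factorial : ℝ)) := by
  have hρ0 : 0 < ρ := by linarith
  have hL : 0 ≤ log ρ := log_nonneg hρ
  have hlayer := lintegral_comp_eq_lintegral_meas_le_mul μ (f := Y)
    (g := fun s ↦ s ^ n / (n.factorial : ℝ)) (Filter.Eventually.of_forall hY0) hY
    (fun t _ ↦ (by fun_prop : Continuous fun s : ℝ ↦ s ^ n / (n.factorial : ℝ)).intervalIntegrable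
      _ _)
    ((ae_restrict_iff' measurableSet_Ioi).2 (Filter.Eventually.of_forall fun s (hs : 0 < s) ↦ by
      positivity))
  simp only [integral_pow_div_factorial] at hlayer
  rw [hlayer, ← Set.Ioc_union_Ioi_eq_Ioi hL,
    lintegral_union measurableSet_Ioi (Set.Ioc_disjoint_Ioi le_rfl)]
  have hsmall : ∫⁻ s in Set.Ioc 0 (log ρ),
      μ {ω | s ≤ Y ω} * ENNReal.ofReal (s ^ n / (n.factorial : ℝ)) ≤
        ENNReal.ofReal (log ρ ^ (n + 1) / ((n + 1).factorial : ℝ)) := by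
    rw [← lintegral_Ioc_pow_div_factorial n hL]
    exact lintegral_mono fun s ↦ mul_le_of_le_one_left' prob_le_one
  have hlarge : ∫⁻ s in Set.Ioi (log ρ),
      μ {ω | s ≤ Y ω} * ENNReal.ofReal (s ^ n / (n.factorial : ℝ)) ≤
        ENNReal.ofReal (∑ i ∈ Finset.range (n + 1), log ρ ^ i / (i.factorial : ℝ)) := by
    calc
      _ ≤ ∫⁻ s in Set.Ioi (log ρ),
          ENNReal.ofReal ρ * ENNReal.ofReal (s ^ n / (n.factorial : ℝ) * exp (-s)) := by
        refine setLIntegral_mono' measurableSet_Ioi fun s hs ↦ ?_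
        have hs0 : 0 ≤ s := hL.trans (le_of_lt hs)
        rw [← ofReal_measureReal, ← ENNReal.ofReal_mul (by positivity),
          ← ENNReal.ofReal_mul hρ0.le]
        refine ENNReal.ofReal_le_ofReal ?_
        calc
          _ ≤ ρ * exp (-s) * (s ^ n / (n.factorial : ℝ)) := by
            gcongr
            exact htail s hs0
          _ = _ := by ring
      _ = _ := by
        rw [lintegral_const_mul' _ _ ENNReal.ofReal_ne_top,
          lintegral_Ioi_pow_div_factorial_mul_exp_neg n hL, ← ENNReal.ofReal_mul hρ0.le,
          exp_neg, exp_log hρ0, mul_inv_cancel_left₀ hρ0.ne']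
  refine (add_le_add hsmall hlarge).trans_eq ?_
  rw [← ENNReal.ofReal_add (by positivity) (by positivity), Finset.sum_range_succ _ (n + 1),
    add_comm]

/-- If `P[|X| ≥ λσ₁] ≤ ρ₁ exp(-λ²/2)` for all `λ ≥ 0`, then for every positive integer `k`,
`E[X^(2k)] ≤ (Σ_{i=0}^k (ln ρ₁)^i / i!) · 2^k σ₁^(2k) k!`. -/
theorem stmt_6 {Ω : Type*} [MeasurableSpace Ω] (μ : Measure Ω) [IsProbabilityMeasure μ]
    (X : Ω → ℝ) (σ₁ ρ₁ : ℝ) (hσ : 0 < σ₁) (hρ : 1 ≤ ρ₁)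
    (htail : ∀ l : ℝ, 0 ≤ l →
      (μ {ω | l * σ₁ ≤ |X ω|}).toReal ≤ ρ₁ * Real.exp (-l ^ 2 / 2)) :
    ∀ k : ℕ, 0 < k →
      ∫ ω, (X ω) ^ (2 * k) ∂μ ≤
        (∑ i ∈ Finset.range (k + 1), (Real.log ρ₁) ^ i / (Nat.factorial i : ℝ)) *
          (2 ^ k * σ₁ ^ (2 * k)) * (Nat.factorial k : ℝ) := by
  intro k hk
  obtain ⟨n, rfl⟩ := Nat.exists_eq_succ_of_ne_zero hk.ne'
  have hL : 0 ≤ log ρ₁ := log_nonneg hρ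
  by_cases hint : Integrable (fun ω ↦ X ω ^ (2 * (n + 1))) μ
  swap
  · rw [integral_undef hint]
    positivity
  have hX2 : AEMeasurable (fun ω ↦ X ω ^ 2) μ := by
    refine (hint.aemeasurable.pow_const ((↑(n + 1) : ℝ)⁻¹)).congr
      (Filter.Eventually.of_forall fun ω ↦ ?_)
    simp only [pow_mul]
    exact pow_rpow_inv_natCast (sq_nonneg _) n.succ_ne_zero
  have hmoment := lintegral_pow_div_factorial_le_of_tail μ (Y := fun ω ↦ X ω ^ 2 / (2 * σ₁ ^ 2))
    (hX2.div_const _) (fun ω ↦ by positivity) hρ (fun s hs ↦ ?_) n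
  · have hscale : ∀ ω, X ω ^ (2 * (n + 1)) = 2 ^ (n + 1) * σ₁ ^ (2 * (n + 1)) *
        ((n + 1).factorial : ℝ) *
          ((X ω ^ 2 / (2 * σ₁ ^ 2)) ^ (n + 1) / ((n + 1).factorial : ℝ)) := fun ω ↦ by
      rw [div_pow, mul_pow, pow_mul, pow_mul]
      field_simp
    simp only [Nat.succ_eq_add_one, hscale]
    rw [integral_const_mul, integral_eq_lintegral_of_nonneg_ae
      (Filter.Eventually.of_forall fun ω ↦ by positivity)
      (((hX2.div_const _).pow_const _).div_const _).aestronglyMeasurable]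
    have hreal := ENNReal.toReal_le_of_le_ofReal (by positivity) hmoment
    calc
      _ ≤ 2 ^ (n + 1) * σ₁ ^ (2 * (n + 1)) * ((n + 1).factorial : ℝ) *
          ∑ i ∈ Finset.range (n + 2), log ρ₁ ^ i / (i.factorial : ℝ) := by gcongr
      _ = _ := by ring
  · have hset : {ω | s ≤ X ω ^ 2 / (2 * σ₁ ^ 2)} = {ω | √(2 * s) * σ₁ ≤ |X ω|} := by
      ext ω
      rw [Set.mem_ofPred_eq, Set.mem_ofPred_eq, le_div_iff₀ (by positivity),
        ← abs_of_nonneg (by positivity : 0 ≤ √(2 * s) * σ₁), ← sq_le_sq, mul_pow,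
        sq_sqrt (by positivity)]
      ring_nf
    have h := htail (√(2 * s)) (sqrt_nonneg _)
    rw [sq_sqrt (by positivity), neg_div, mul_div_cancel_left₀ s two_ne_zero] at h
    rw [hset]
    exact h
end

section
/- Let X be a real random variable, σ₁ > 0 and ρ₁ ≥ 1 constants such that P[|X| ≥ λσ₁] ≤ ρ₁·exp(−λ²/2) for all λ ≥ 0. Then for every λ ∈ [0,1), E[exp(λ X²/(2σ₁²))] ≤ ρ₁^λ / (1−λ). -/
open MeasureTheory Real

/-- A nonnegative random variable whose tail is at most `c * t ^ (-p)` beyond `a > 0`, where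
`1 < p`, has mean at most `a + ∫ t in Ioi a, c * t ^ (-p)`, the last integral being computed. -/
theorem integral_le_of_measureReal_ge_le_mul_rpow {Ω : Type*} [MeasurableSpace Ω] {μ : Measure Ω}
    [IsProbabilityMeasure μ] {f : Ω → ℝ} (hf : Integrable f μ) (hf_nn : 0 ≤ f) {c p a : ℝ}
    (hp : 1 < p) (ha : 0 < a)
    (htail : ∀ t, a < t → μ.real {ω | t ≤ f ω} ≤ c * t ^ (-p)) :
    ∫ ω, f ω ∂μ ≤ a + c * (-a ^ (-p + 1) / (-p + 1)) := by
  have hint : IntegrableOn (fun t : ℝ ↦ c * t ^ (-p)) (Set.Ioi a) :=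
    (integrableOn_Ioi_rpow_of_lt (by linarith) ha).const_mul c
  have hone : IntegrableOn (fun _ : ℝ ↦ (1 : ℝ)) (Set.Ioc 0 a) := by simp
  have hsub : Set.Ioc 0 a ⊆ Set.Ioi (0 : ℝ) := Set.Ioc_subset_Ioi_self
  have hsub' : Set.Ioi a ⊆ Set.Ioi (0 : ℝ) := Set.Ioi_subset_Ioi ha.le
  have h₁ := (hone.integrable_indicator measurableSet_Ioc).integrableOn (s := Set.Ioi (0 : ℝ))
  have h₂ := (hint.integrable_indicator measurableSet_Ioi).integrableOn (s := Set.Ioi (0 : ℝ))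
  rw [hf.integral_eq_integral_meas_le (Filter.Eventually.of_forall hf_nn)]
  calc ∫ t in Set.Ioi 0, μ.real {ω | t ≤ f ω}
      ≤ ∫ t in Set.Ioi 0, ((Set.Ioc 0 a).indicator (fun _ ↦ (1 : ℝ)) t +
          (Set.Ioi a).indicator (fun t ↦ c * t ^ (-p)) t) := by
        refine integral_mono_of_nonneg (Filter.Eventually.of_forall fun _ ↦ measureReal_nonneg)
          (h₁.add h₂) ?_
        filter_upwards [ae_restrict_mem measurableSet_Ioi] with t (ht : 0 < t)
        rcases le_or_gt t a with hta | hta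
        · simp [ht, hta, hta.not_gt]
        · simpa [hta, hta.not_ge] using htail t hta
    _ = a + c * (-a ^ (-p + 1) / (-p + 1)) := by
        rw [integral_add h₁ h₂, setIntegral_indicator measurableSet_Ioc,
          setIntegral_indicator measurableSet_Ioi, Set.inter_eq_right.mpr hsub,
          Set.inter_eq_right.mpr hsub', integral_const_mul,
          integral_Ioi_rpow_of_lt (by linarith) ha]
        simp [ha.le]

/-- If `P[|X| ≥ λσ₁] ≤ ρ₁ exp(-λ²/2)` for all `λ ≥ 0`, then
`E[exp(λ X²/(2σ₁²))] ≤ ρ₁^λ / (1-λ)` for every `λ ∈ [0,1)`. -/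
theorem stmt_7 {Ω : Type*} [MeasurableSpace Ω] (μ : Measure Ω) [IsProbabilityMeasure μ]
    (X : Ω → ℝ) (σ₁ ρ₁ : ℝ) (hσ : 0 < σ₁) (hρ : 1 ≤ ρ₁)
    (htail : ∀ l : ℝ, 0 ≤ l →
      (μ {ω | l * σ₁ ≤ |X ω|}).toReal ≤ ρ₁ * Real.exp (-l ^ 2 / 2)) :
    ∀ l : ℝ, 0 ≤ l → l < 1 →
      ∫ ω, Real.exp (l * (X ω) ^ 2 / (2 * σ₁ ^ 2)) ∂μ ≤ ρ₁ ^ l / (1 - l) := by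
  intro l hl hl1
  have hρ0 : 0 < ρ₁ := by linarith
  have hl1' : 0 < 1 - l := by linarith
  rcases hl.eq_or_lt with rfl | hl0
  · simp
  by_cases hint : Integrable (fun ω ↦ Real.exp (l * (X ω) ^ 2 / (2 * σ₁ ^ 2))) μ
  swap
  · rw [integral_undef hint]
    positivity
  refine (integral_le_of_measureReal_ge_le_mul_rpow (c := ρ₁) (p := 1 / l) (a := ρ₁ ^ l) hint
    (fun ω ↦ (exp_pos _).le) ((one_lt_div hl0).mpr hl1) (by positivity) ?_).trans_eq ?_
  · intro t ht
    have ht1 : 1 < t := (one_le_rpow hρ hl).trans_lt ht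
    have hlog : 0 < Real.log t := Real.log_pos ht1
    have hsq : √(2 * Real.log t / l) ^ 2 = 2 * Real.log t / l := sq_sqrt (by positivity)
    have hbound := htail √(2 * Real.log t / l) (sqrt_nonneg _)
    have hexp : Real.exp (-√(2 * Real.log t / l) ^ 2 / 2) = t ^ (-(1 / l)) := by
      rw [hsq, rpow_def_of_pos (by linarith)]
      congr 1
      field_simp
    rw [hexp] at hbound
    refine (measureReal_mono fun ω hω ↦ ?_).trans hbound
    have hω' : Real.log t ≤ l * X ω ^ 2 / (2 * σ₁ ^ 2) :=
      (log_le_iff_le_exp (by linarith)).mpr hω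
    refine le_of_pow_le_pow_left₀ two_ne_zero (abs_nonneg (X ω)) ?_
    rw [mul_pow, hsq, sq_abs, div_mul_eq_mul_div, div_le_iff₀ hl0]
    rw [le_div_iff₀ (by positivity)] at hω'
    linarith
  · have hpow : (ρ₁ ^ l) ^ (-(1 / l) + 1) = ρ₁ ^ l / ρ₁ := by
      rw [← rpow_mul hρ0.le, ← rpow_sub_one hρ0.ne']
      congr 1
      field_simp
      ring
    have hne : -(1 / l) + 1 = -((1 - l) / l) := by
      field_simp
      ring
    rw [hpow, hne]
    field_simp
    ring
end

section
/- Let X be a real random variable with E[X] = 0, and suppose P[|X| ≥ λσ₁] ≤ ρ₁·exp(−λ²/2) for all λ ≥ 0, with σ₁ > 0 and ρ₁ ≥ 1. Then E[exp(λX)] ≤ exp(σ²λ²/2) for all λ ∈ ℝ, where σ² = σ₁²·(8 + 7·ln ρ₁)/3. -/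
open MeasureTheory Real

lemma exp_sub_one_le_mul_exp_sub_self {y : ℝ} (hy : 0 ≤ y) :
    exp y - 1 ≤ 7 / 6 * y * (exp y - y) := by
  rcases le_total (6 / 7) y with h | h
  · have h2 := Real.quadratic_le_exp_of_nonneg hy
    have h3 : (7 / 6 * y - 1) * (1 + y + y ^ 2 / 2) ≤ (7 / 6 * y - 1) * exp y :=
      mul_le_mul_of_nonneg_left h2 (by linarith)
    have h4 : 0 ≤ y * (7 / 12 * y ^ 2 - y / 2 + 1 / 6) :=
      mul_nonneg hy (by nlinarith [sq_nonneg (y - 3 / 7)])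
    nlinarith
  · have h2 := Real.exp_bound' hy (by linarith) (n := 4) (by norm_num)
    norm_num [Finset.sum_range_succ, Nat.factorial] at h2
    have h3 : (1 - 7 / 6 * y) * exp y ≤
        (1 - 7 / 6 * y) * (1 + y + y ^ 2 / 2 + y ^ 3 / 6 + 5 / 96 * y ^ 4) :=
      mul_le_mul_of_nonneg_left (by linarith) (by linarith)
    have h4 : 0 ≤ y * (1 / 6 - y / 2 + 5 / 12 * y ^ 2) :=
      mul_nonneg hy (by nlinarith [sq_nonneg (y - 3 / 5)])
    have h5 : 0 ≤ y ^ 4 := by positivity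
    have h6 : 0 ≤ y ^ 5 := by positivity
    nlinarith

lemma exp_sub_self_le_mul_exp {y z : ℝ} (hy : 0 ≤ y) (hyz : y ≤ z) :
    exp z - z ≤ (exp y - y) * exp (7 / 12 * (z ^ 2 - y ^ 2)) := by
  have hder : ∀ x : ℝ, HasDerivAt (fun x => (exp x - x) * exp (-(7 / 12 * x ^ 2)))
      ((exp x - 1 - 7 / 6 * x * (exp x - x)) * exp (-(7 / 12 * x ^ 2))) x := by
    intro x
    have h1 := (Real.hasDerivAt_exp x).sub (hasDerivAt_id x)
    have h2 := (((hasDerivAt_pow 2 x).const_mul (7 / 12 : ℝ)).neg).exp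
    refine (h1.mul h2).congr_deriv ?_
    simp
    ring
  have hanti : AntitoneOn (fun x => (exp x - x) * exp (-(7 / 12 * x ^ 2))) (Set.Ici 0) := by
    refine antitoneOn_of_deriv_nonpos (convex_Ici 0)
      (fun x _ => (hder x).continuousAt.continuousWithinAt)
      (fun x _ => (hder x).differentiableAt.differentiableWithinAt) fun x hx => ?_
    rw [(hder x).deriv]
    have hx0 : 0 ≤ x := interior_subset hx
    exact mul_nonpos_of_nonpos_of_nonneg
      (by linarith [exp_sub_one_le_mul_exp_sub_self hx0]) (exp_pos _).le
  have h := hanti (Set.mem_Ici.2 hy) (Set.mem_Ici.2 (hy.trans hyz)) hyz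
  have h' := mul_le_mul_of_nonneg_right h (exp_pos (7 / 12 * z ^ 2)).le
  simp only [mul_assoc, ← exp_add] at h'
  rw [neg_add_cancel, exp_zero, mul_one,
    show -(7 / 12 * y ^ 2) + 7 / 12 * z ^ 2 = 7 / 12 * (z ^ 2 - y ^ 2) by ring] at h'
  exact h'

lemma exp_sub_self_le_exp_abs_sub_abs (x : ℝ) : exp x - x ≤ exp |x| - |x| := by
  rcases le_total 0 x with h | h
  · rw [abs_of_nonneg h]
  · rw [abs_of_nonpos h]
    have := Real.self_le_sinh_iff.2 (neg_nonneg.2 h)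
    rw [Real.sinh_eq, neg_neg] at this
    linarith

lemma one_add_mul_exp_half_le_exp {u : ℝ} (hu : 0 ≤ u) :
    1 + (u * exp (u / 2) + (3 / 5 * u + 2 / 3) * (exp (u / 2) - 1)) ≤ exp (4 / 3 * u) := by
  have hsplit : exp (4 / 3 * u) = exp (u / 2) * exp (5 / 6 * u) := by
    rw [← exp_add]; ring_nf
  have h1 := Real.sum_le_exp_of_nonneg (x := 5 / 6 * u) (by positivity) 6
  norm_num [Finset.sum_range_succ, Nat.factorial] at h1
  have h2 := Real.quadratic_le_exp_of_nonneg (x := u / 2) (by positivity)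
  have hB : 0 ≤ 1 / 3 - 23 / 30 * u + 25 / 72 * u ^ 2 + 125 / 1296 * u ^ 3
      + 625 / 31104 * u ^ 4 + 625 / 186624 * u ^ 5 := by
    have h := sq_nonneg (u - 39 / 50)
    nlinarith [h, sq_nonneg (u - 79 / 100), mul_nonneg hu h, mul_nonneg (pow_nonneg hu 2) h,
      mul_nonneg (pow_nonneg hu 3) h]
  have h3 := mul_le_mul_of_nonneg_left h1 (exp_pos (u / 2)).le
  have h4 := mul_le_mul_of_nonneg_right h2 hB
  have e2 : 0 ≤ u ^ 2 := by positivity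
  have e3 : 0 ≤ u ^ 3 := by positivity
  have e4 : 0 ≤ u ^ 4 := by positivity
  have e5 : 0 ≤ u ^ 5 := by positivity
  have e6 : 0 ≤ u ^ 6 := by positivity
  have e7 : 0 ≤ u ^ 7 := by positivity
  rw [hsplit]
  nlinarith

lemma integrable_exp_mul_sub_sq_half (s : ℝ) :
    Integrable fun t : ℝ => exp (s * t - t ^ 2 / 2) := by
  have h := ((integrable_exp_neg_mul_sq (b := 1 / 2) (by norm_num)).comp_sub_right s).const_mul
    (exp (s ^ 2 / 2))
  refine h.congr (Filter.Eventually.of_forall fun t => ?_)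
  simp only [← exp_add]
  ring_nf

lemma setIntegral_exp_neg_sq_half_Ioi : ∫ t in Set.Ioi (0 : ℝ), exp (-(t ^ 2 / 2)) = √(π / 2) := by
  have h := integral_gaussian_Ioi (1 / 2)
  have h4 : √(π / (1 / 2)) = 2 * √(π / 2) := by
    rw [show π / (1 / 2) = 2 ^ 2 * (π / 2) by ring, Real.sqrt_mul (by norm_num),
      Real.sqrt_sq (by norm_num)]
  rw [h4] at h
  rw [show √(π / 2) = 2 * √(π / 2) / 2 by ring, ← h]
  congr 1 with t
  ring_nf

lemma setIntegral_exp_mul_sub_sq_half_Ioi_le {s : ℝ} (hs : 0 ≤ s) :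
    ∫ t in Set.Ioi (0 : ℝ), exp (s * t - t ^ 2 / 2) ≤ exp (s ^ 2 / 2) * (s + √(π / 2)) := by
  have hint : Integrable fun t : ℝ => exp (-(t ^ 2 / 2)) := by
    simpa using integrable_exp_mul_sub_sq_half 0
  have hshift : ∫ t in Set.Ioi (0 : ℝ), exp (s * t - t ^ 2 / 2) =
      exp (s ^ 2 / 2) * ∫ t in Set.Ioi (-s), exp (-(t ^ 2 / 2)) := by
    rw [← integral_const_mul, ← integral_indicator measurableSet_Ioi,
      ← integral_indicator measurableSet_Ioi,
      ← integral_sub_right_eq_self ((Set.Ioi (-s)).indicator _) s]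
    congr 1 with t
    simp only [Set.indicator_apply, Set.mem_Ioi, neg_lt_sub_iff_lt_add, ← exp_add]
    simp only [lt_add_iff_pos_right]
    split_ifs <;> ring_nf
  rw [hshift]
  refine mul_le_mul_of_nonneg_left ?_ (exp_pos _).le
  rw [← Set.Ioc_union_Ioi_eq_Ioi (neg_nonpos.2 hs), setIntegral_union
    (Set.Ioc_disjoint_Ioi le_rfl) measurableSet_Ioi hint.integrableOn hint.integrableOn,
    setIntegral_exp_neg_sq_half_Ioi]
  refine add_le_add_left ?_ _
  calc ∫ t in Set.Ioc (-s) 0, exp (-(t ^ 2 / 2)) ≤ ∫ t in Set.Ioc (-s) 0, (1 : ℝ) :=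
        setIntegral_mono hint.integrableOn (integrableOn_const (by simp))
          fun t => exp_le_one_iff.2 (by have := sq_nonneg t; linarith)
    _ = s := by simp [hs]

lemma lintegral_mul_exp_sub_one_mul_exp_le {s : ℝ} (hs : 0 ≤ s) :
    ∫⁻ t in Set.Ioi (0 : ℝ), ENNReal.ofReal (exp (-t ^ 2 / 2)) *
      ENNReal.ofReal (s * (exp (s * t) - 1)) ≤ ENNReal.ofReal (exp (4 / 3 * s ^ 2) - 1) := by
  have hi1 := (integrable_exp_mul_sub_sq_half s).integrableOn (s := Set.Ioi 0)
  have hi0 : IntegrableOn (fun t : ℝ => exp (-(t ^ 2 / 2))) (Set.Ioi 0) := by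
    simpa using (integrable_exp_mul_sub_sq_half 0).integrableOn (s := Set.Ioi 0)
  have hi := (hi1.sub hi0).const_mul s
  have hnn : ∀ t ∈ Set.Ioi (0 : ℝ), 0 ≤ s * (exp (s * t - t ^ 2 / 2) - exp (-(t ^ 2 / 2))) := by
    intro t ht
    have : 0 ≤ s * t := mul_nonneg hs (le_of_lt ht)
    exact mul_nonneg hs (sub_nonneg.2 (exp_le_exp.2 (by linarith)))
  calc _ = ∫⁻ t in Set.Ioi (0 : ℝ),
        ENNReal.ofReal (s * (exp (s * t - t ^ 2 / 2) - exp (-(t ^ 2 / 2)))) := by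
        refine lintegral_congr fun t => ?_
        rw [← ENNReal.ofReal_mul (exp_pos _).le, sub_eq_add_neg (s * t), exp_add]
        ring_nf
    _ = ENNReal.ofReal (∫ t in Set.Ioi (0 : ℝ),
        s * (exp (s * t - t ^ 2 / 2) - exp (-(t ^ 2 / 2)))) :=
        (ofReal_integral_eq_lintegral_ofReal hi
          ((ae_restrict_iff' measurableSet_Ioi).2 (Filter.Eventually.of_forall hnn))).symm
    _ ≤ _ := by
        refine ENNReal.ofReal_le_ofReal ?_
        rw [integral_const_mul, integral_sub hi1 hi0, setIntegral_exp_neg_sq_half_Ioi]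
        have h1 := mul_le_mul_of_nonneg_left (setIntegral_exp_mul_sub_sq_half_Ioi_le hs) hs
        have h2 := one_add_mul_exp_half_le_exp (sq_nonneg s)
        have h3 : s * √(π / 2) ≤ 3 / 5 * s ^ 2 + 2 / 3 := by
          have hq : √(π / 2) ^ 2 = π / 2 := Real.sq_sqrt (by positivity)
          nlinarith [sq_nonneg (s - 5 / 6 * √(π / 2)), Real.pi_lt_d2]
        have h4 : 0 ≤ exp (s ^ 2 / 2) - 1 := by
          have := Real.add_one_le_exp (s ^ 2 / 2)
          nlinarith [sq_nonneg s]
        have h5 := mul_le_mul_of_nonneg_right h3 h4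
        nlinarith

/-- If the tail of `Y ≥ 0` is dominated by that of the Rayleigh distribution, then
`E[exp (s Y) - s Y] ≤ exp (4 s² / 3)`. -/
lemma lintegral_exp_mul_sub_mul_le {Ω : Type*} [MeasurableSpace Ω] (μ : Measure Ω)
    [IsProbabilityMeasure μ] {Y : Ω → ℝ} (hY : AEMeasurable Y μ) (hY0 : ∀ ω, 0 ≤ Y ω)
    (htail : ∀ t : ℝ, 0 < t → μ {ω | t ≤ Y ω} ≤ ENNReal.ofReal (exp (-t ^ 2 / 2)))
    {s : ℝ} (hs : 0 ≤ s) :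
    ∫⁻ ω, ENNReal.ofReal (exp (s * Y ω) - s * Y ω) ∂μ ≤ ENNReal.ofReal (exp (4 / 3 * s ^ 2)) := by
  have hderiv : ∀ t : ℝ, HasDerivAt (fun t => exp (s * t) - s * t) (s * (exp (s * t) - 1)) t := by
    intro t
    have h := (hasDerivAt_id t).const_mul s
    refine (h.exp.sub h).congr_deriv ?_
    simp
    ring
  have hcont : Continuous fun t : ℝ => s * (exp (s * t) - 1) := by fun_prop
  have hprim : ∀ y : ℝ, ∫ t in (0 : ℝ)..y, s * (exp (s * t) - 1) = exp (s * y) - s * y - 1 := by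
    intro y
    rw [intervalIntegral.integral_eq_sub_of_hasDerivAt (fun t _ => hderiv t)
      (hcont.intervalIntegrable _ _)]
    simp
  have hcake := lintegral_comp_eq_lintegral_meas_le_mul μ (f := Y)
    (g := fun t => s * (exp (s * t) - 1)) (Filter.Eventually.of_forall hY0) hY
    (fun t _ => hcont.intervalIntegrable _ _)
    ((ae_restrict_iff' measurableSet_Ioi).2 (Filter.Eventually.of_forall fun t ht =>
      mul_nonneg hs (sub_nonneg.2 (one_le_exp (mul_nonneg hs (le_of_lt ht))))))
  simp only [hprim] at hcake
  have hone : 1 ≤ exp (4 / 3 * s ^ 2) := one_le_exp (by positivity)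
  calc ∫⁻ ω, ENNReal.ofReal (exp (s * Y ω) - s * Y ω) ∂μ
      = ∫⁻ ω, (ENNReal.ofReal (exp (s * Y ω) - s * Y ω - 1) + 1) ∂μ := by
        refine lintegral_congr fun ω => ?_
        rw [← ENNReal.ofReal_one, ← ENNReal.ofReal_add _ zero_le_one, sub_add_cancel]
        linarith [Real.add_one_le_exp (s * Y ω)]
    _ = (∫⁻ t in Set.Ioi 0, μ {ω | t ≤ Y ω} * ENNReal.ofReal (s * (exp (s * t) - 1))) + 1 := by
        rw [lintegral_add_right _ measurable_const, hcake]
        simp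
    _ ≤ ENNReal.ofReal (exp (4 / 3 * s ^ 2) - 1) + 1 := by
        refine add_le_add_left ((setLIntegral_mono' measurableSet_Ioi fun t ht => ?_).trans
          (lintegral_mul_exp_sub_one_mul_exp_le hs)) _
        exact mul_le_mul_left (htail t ht) _
    _ = _ := by
        rw [← ENNReal.ofReal_one, ← ENNReal.ofReal_add (by linarith) zero_le_one, sub_add_cancel]

/-- A subgaussian tail with prefactor `ρ` bounds `E[exp (s |Z|) - s |Z|]`. -/
lemma lintegral_exp_abs_sub_abs_le {Ω : Type*} [MeasurableSpace Ω] (μ : Measure Ω)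
    [IsProbabilityMeasure μ] {Z : Ω → ℝ} (hZ : AEMeasurable Z μ) {ρ : ℝ} (hρ : 1 ≤ ρ)
    (htail : ∀ t : ℝ, 0 ≤ t → (μ {ω | t ≤ |Z ω|}).toReal ≤ ρ * exp (-t ^ 2 / 2))
    {s : ℝ} (hs : 0 ≤ s) :
    ∫⁻ ω, ENNReal.ofReal (exp (s * |Z ω|) - s * |Z ω|) ∂μ ≤
      ENNReal.ofReal (exp ((8 + 7 * log ρ) / 6 * s ^ 2)) := by
  have hL : 0 ≤ log ρ := log_nonneg hρ
  set Y : Ω → ℝ := fun ω => √(Z ω ^ 2 - 2 * log ρ) with hYdef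
  have hYm : AEMeasurable Y μ := ((hZ.pow_const 2).sub_const _).sqrt
  have hYle : ∀ ω, Y ω ≤ |Z ω| := fun ω => by
    rw [← Real.sqrt_sq_eq_abs]
    exact Real.sqrt_le_sqrt (by linarith)
  have hYsq : ∀ ω, Z ω ^ 2 - Y ω ^ 2 ≤ 2 * log ρ := fun ω => by
    rcases le_total 0 (Z ω ^ 2 - 2 * log ρ) with h | h
    · have := Real.sq_sqrt h
      simp only [hYdef]
      linarith
    · have := sq_nonneg (Y ω)
      linarith
  have hYtail : ∀ t : ℝ, 0 < t → μ {ω | t ≤ Y ω} ≤ ENNReal.ofReal (exp (-t ^ 2 / 2)) := by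
    intro t ht
    have hr := htail (√(t ^ 2 + 2 * log ρ)) (Real.sqrt_nonneg _)
    rw [Real.sq_sqrt (by positivity), show -(t ^ 2 + 2 * log ρ) / 2 = -t ^ 2 / 2 - log ρ by ring,
      exp_sub, exp_log (by linarith), mul_div_cancel₀ _ (by linarith)] at hr
    rw [← ENNReal.toReal_le_toReal (measure_ne_top _ _) ENNReal.ofReal_ne_top,
      ENNReal.toReal_ofReal (exp_pos _).le]
    refine le_trans (ENNReal.toReal_mono (measure_ne_top _ _) (measure_mono fun ω hω => ?_)) hr
    have h1 : t ^ 2 ≤ Z ω ^ 2 - 2 * log ρ := (Real.le_sqrt' ht).1 hω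
    simp only [Set.mem_ofPred_eq]
    rw [← Real.sqrt_sq_eq_abs]
    exact Real.sqrt_le_sqrt (by linarith)
  calc ∫⁻ ω, ENNReal.ofReal (exp (s * |Z ω|) - s * |Z ω|) ∂μ
      ≤ ∫⁻ ω, ENNReal.ofReal (exp (s * Y ω) - s * Y ω) *
          ENNReal.ofReal (exp (7 / 6 * log ρ * s ^ 2)) ∂μ := by
        refine lintegral_mono fun ω => ?_
        have hpos : 0 ≤ exp (s * Y ω) - s * Y ω := by linarith [Real.add_one_le_exp (s * Y ω)]
        rw [← ENNReal.ofReal_mul hpos]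
        refine ENNReal.ofReal_le_ofReal ((exp_sub_self_le_mul_exp
          (mul_nonneg hs (Real.sqrt_nonneg _)) (mul_le_mul_of_nonneg_left (hYle ω) hs)).trans
          (mul_le_mul_of_nonneg_left (exp_le_exp.2 ?_) hpos))
        have := mul_le_mul_of_nonneg_left (hYsq ω) (sq_nonneg s)
        rw [mul_pow, mul_pow, sq_abs]
        linarith
    _ = (∫⁻ ω, ENNReal.ofReal (exp (s * Y ω) - s * Y ω) ∂μ) *
          ENNReal.ofReal (exp (7 / 6 * log ρ * s ^ 2)) :=
        lintegral_mul_const' _ _ ENNReal.ofReal_ne_top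
    _ ≤ ENNReal.ofReal (exp (4 / 3 * s ^ 2)) * ENNReal.ofReal (exp (7 / 6 * log ρ * s ^ 2)) :=
        mul_le_mul_left
          (lintegral_exp_mul_sub_mul_le μ hYm (fun _ => Real.sqrt_nonneg _) hYtail hs) _
    _ = _ := by
        rw [← ENNReal.ofReal_mul (exp_pos _).le, ← exp_add]
        ring_nf

/-- If `E[X] = 0` and `P[|X| ≥ λσ₁] ≤ ρ₁ exp(-λ²/2)` for all `λ ≥ 0`, then `X` is
`(σ,1)`-subgaussian with `σ² = σ₁²(8 + 7 ln ρ₁)/3`. -/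
theorem stmt_11 {Ω : Type*} [MeasurableSpace Ω] (μ : Measure Ω) [IsProbabilityMeasure μ]
    (X : Ω → ℝ) (σ₁ ρ₁ : ℝ) (hσ : 0 < σ₁) (hρ : 1 ≤ ρ₁)
    (hmean : ∫ ω, X ω ∂μ = 0)
    (htail : ∀ l : ℝ, 0 ≤ l →
      (μ {ω | l * σ₁ ≤ |X ω|}).toReal ≤ ρ₁ * Real.exp (-l ^ 2 / 2)) :
    ∀ l : ℝ, ∫ ω, Real.exp (l * X ω) ∂μ ≤
      Real.exp (σ₁ ^ 2 * (8 + 7 * Real.log ρ₁) / 3 * l ^ 2 / 2) := by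
  intro l
  rcases eq_or_ne l 0 with rfl | hl
  · simp
  by_cases hint : Integrable (fun ω => exp (l * X ω)) μ
  swap
  · rw [integral_undef hint]
    exact (exp_pos _).le
  have hX : AEMeasurable X μ := by
    have h := hint.aestronglyMeasurable.aemeasurable.log.const_mul l⁻¹
    simpa [hl] using h
  have hbound := lintegral_exp_abs_sub_abs_le μ (hX.div_const σ₁) hρ (fun t ht => by
    simpa only [abs_div, abs_of_pos hσ, le_div_iff₀ hσ] using htail t ht)
    (s := |l| * σ₁) (by positivity)
  have habs : ∀ ω, |l| * σ₁ * |X ω / σ₁| = |l * X ω| := fun ω => by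
    rw [abs_div, abs_of_pos hσ, abs_mul]
    field_simp
  simp only [habs] at hbound
  have hfpos : ∀ ω, 0 ≤ exp |l * X ω| - |l * X ω| := fun ω => by
    linarith [Real.add_one_le_exp |l * X ω|]
  have hfm : AEMeasurable (fun ω => exp |l * X ω| - |l * X ω|) μ := by fun_prop
  have hfint : Integrable (fun ω => exp |l * X ω| - |l * X ω|) μ :=
    ⟨hfm.aestronglyMeasurable, (hasFiniteIntegral_iff_ofReal (Filter.Eventually.of_forall hfpos)).2
      (hbound.trans_lt ENNReal.ofReal_lt_top)⟩
  have hlX : Integrable (fun ω => l * X ω) μ :=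
    hfint.mono' (hX.const_mul l).aestronglyMeasurable (Filter.Eventually.of_forall fun ω => by
      have := Real.quadratic_le_exp_of_nonneg (abs_nonneg (l * X ω))
      rw [Real.norm_eq_abs]
      nlinarith [sq_nonneg (|l * X ω| - 1)])
  calc ∫ ω, exp (l * X ω) ∂μ = ∫ ω, (exp (l * X ω) - l * X ω) ∂μ := by
        rw [integral_sub hint hlX, integral_const_mul, hmean, mul_zero, sub_zero]
    _ ≤ ∫ ω, (exp |l * X ω| - |l * X ω|) ∂μ :=
        integral_mono (hint.sub hlX) hfint fun ω => exp_sub_self_le_exp_abs_sub_abs _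
    _ ≤ exp ((8 + 7 * log ρ₁) / 6 * (|l| * σ₁) ^ 2) := by
        rw [integral_eq_lintegral_of_nonneg_ae (Filter.Eventually.of_forall hfpos)
          hfm.aestronglyMeasurable]
        exact ENNReal.toReal_le_of_le_ofReal (exp_pos _).le hbound
    _ = _ := by
        rw [mul_pow, sq_abs]
        ring_nf
end
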